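/- Let F be the finite field of order 169 and let α ∈ F satisfy α² = 6. Set C := {0, 1, 3, 4, 7(α+1), 2(α+1), 7(α+7)}. Then the orbit of C under the natural action of the automorphism group of the Paley graph P(169) on vertex subsets equals the collection of all sets {s·x + γ : x ∈ C}, where s ranges over the nonzero squares of F and γ ranges over F; moreover this orbit has cardinality 14196. -/

import Mathlib

/-- A subset `C` of a field is a clique in the Paley graph: any two distinct
elements differ by a nonzero square. -/
def IsPaleyClique {F : Type*} [Field F] (C : Set F) : Prop :=
  ∀ a ∈ C, ∀ b ∈ C, a ≠ b → IsSquare (a - b)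

/-- A maximal clique in the Paley graph. -/
def IsMaximalPaleyClique {F : Type*} [Field F] (C : Set F) : Prop :=
  IsPaleyClique C ∧ ∀ D : Set F, IsPaleyClique D → C ⊆ D → D = C

/-- A bijection of the field is an automorphism of the Paley graph if it
preserves the adjacency relation. -/
def IsPaleyAut {F : Type*} [Field F] (f : Equiv.Perm F) : Prop :=
  ∀ a b : F, (f a ≠ f b ∧ IsSquare (f a - f b)) ↔ (a ≠ b ∧ IsSquare (a - b))

/-- The setwise stabilizer of a vertex subset `C` inside the automorphism
group of the Paley graph. -/
def paleyStab {F : Type*} [Field F] (C : Set F) : Set (Equiv.Perm F) :=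
  {f | IsPaleyAut f ∧ ⇑f '' C = C}

/-- The orbit of a vertex subset `C` under the natural action of the
automorphism group of the Paley graph on vertex subsets. -/
def paleyOrbit {F : Type*} [Field F] (C : Set F) : Set (Set F) :=
  {D | ∃ f : Equiv.Perm F, IsPaleyAut f ∧ ⇑f '' C = D}

/-- The norm form `a² - 6 b²` evaluated at the difference of two field elements, where
`i : Fin 169` encodes the element `i % 13 + (i / 13) α`. -/
def codeNorm (i j : Fin 169) : ℕ :=
  (i.val % 13 + 13 - j.val % 13) ^ 2 + 7 * (i.val / 13 + 13 - j.val / 13) ^ 2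

/-- Adjacency in the Paley graph of order 169, in terms of codes. -/
def codeAdj (i j : Fin 169) : Bool :=
  codeNorm i j ^ 6 % 13 == 1

/-- The number of neighbours of `i` satisfying `S`. -/
def neighborCount (S : Fin 169 → Bool) (i : Fin 169) : ℕ :=
  (Finset.univ.filter fun j => (S j && codeAdj i j) = true).card

/-- The number of common neighbours of `a`, `b` and `i`. -/
def commonCount (a b i : Fin 169) : ℕ :=
  neighborCount (fun j => codeAdj a j && codeAdj b j) i

/-- Codes of the vertices adjacent to neither `0` nor `1` having exactly 23 common neighbours
with them. -/
def sparseCell (i : Fin 169) : Bool :=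
  i == 58 || i == 60 || i == 123 || i == 125

theorem eq_of_codeNorm : ∀ i j : Fin 169, codeNorm i j % 13 = 0 → i = j := by
  decide +kernel

theorem card_codeAdj_zero :
    (Finset.univ.filter fun i => codeAdj i 0 = true).card = 84 := by
  decide +kernel

theorem sparseCell_eq : ∀ i : Fin 169,
    sparseCell i = (!codeAdj 0 i && !codeAdj 1 i && commonCount 0 1 i == 23) := by
  decide +kernel

theorem eq_or_eq_of_cell_invariants : ∀ i : Fin 169,
    codeAdj 0 i = codeAdj 0 98 → codeAdj 1 i = codeAdj 1 98 →
    commonCount 0 1 i = commonCount 0 1 98 →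
    neighborCount sparseCell i = neighborCount sparseCell 98 → i = 98 ∨ i = 85 := by
  decide +kernel

/-- The adjacency and common neighbour invariants of `i` relative to the vertices `0`, `1`, `b`. -/
def baseInvariant (b i : Fin 169) : Bool × Bool × Bool × ℕ × ℕ × ℕ :=
  (codeAdj 0 i, codeAdj 1 i, codeAdj b i, commonCount 0 1 i, commonCount 0 b i, commonCount 1 b i)

/-- The vertices `3`, `4`, `2 (α + 1)`, `7 (α + 7)` are determined by their invariants relative to
`0`, `1` and `7 (α + 1)`. -/
theorem eq_of_baseInvariant : ∀ i : Fin 169,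
    (baseInvariant 98 i = baseInvariant 98 3 → i = 3) ∧
    (baseInvariant 98 i = baseInvariant 98 4 → i = 4) ∧
    (baseInvariant 98 i = baseInvariant 98 28 → i = 28) ∧
    (baseInvariant 98 i = baseInvariant 98 101 → i = 101) := by
  simp only [baseInvariant, Prod.mk.injEq]
  decide +kernel

/-- If the base vertex `7 (α + 1)` is replaced by its conjugate, the invariants determine the
conjugate vertices. -/
theorem eq_of_conj_baseInvariant : ∀ i : Fin 169,
    (baseInvariant 85 i = baseInvariant 98 3 → i = 3) ∧
    (baseInvariant 85 i = baseInvariant 98 4 → i = 4) ∧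
    (baseInvariant 85 i = baseInvariant 98 28 → i = 145) ∧
    (baseInvariant 85 i = baseInvariant 98 101 → i = 88) := by
  simp only [baseInvariant, Prod.mk.injEq]
  decide +kernel

section Automorphism

variable {g : Equiv.Perm (Fin 169)}

theorem neighborCount_apply (hg : ∀ i j, codeAdj (g i) (g j) = codeAdj i j) {S T : Fin 169 → Bool}
    (hST : ∀ j, T (g j) = S j) (i : Fin 169) : neighborCount T (g i) = neighborCount S i :=
  (Finset.card_equiv g fun j => by simp [hg, hST]).symm

theorem commonCount_apply (hg : ∀ i j, codeAdj (g i) (g j) = codeAdj i j) (a b i : Fin 169) :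
    commonCount (g a) (g b) (g i) = commonCount a b i :=
  neighborCount_apply hg (fun j => by rw [hg, hg]) i

theorem sparseCell_apply (hg : ∀ i j, codeAdj (g i) (g j) = codeAdj i j) (h0 : g 0 = 0)
    (h1 : g 1 = 1) (i : Fin 169) : sparseCell (g i) = sparseCell i := by
  have a0 := hg 0 i
  have a1 := hg 1 i
  have c := commonCount_apply hg 0 1 i
  rw [h0] at a0
  rw [h1] at a1
  rw [h0, h1] at c
  rw [sparseCell_eq, sparseCell_eq, a0, a1, c]

theorem baseInvariant_apply (hg : ∀ i j, codeAdj (g i) (g j) = codeAdj i j) (h0 : g 0 = 0)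
    (h1 : g 1 = 1) (b i : Fin 169) : baseInvariant (g b) (g i) = baseInvariant b i := by
  have a0 := hg 0 i
  have a1 := hg 1 i
  have c := commonCount_apply hg 0 1 i
  have c0 := commonCount_apply hg 0 b i
  have c1 := commonCount_apply hg 1 b i
  rw [h0] at a0 c0
  rw [h1] at a1 c1
  rw [h0, h1] at c
  simp only [baseInvariant, a0, a1, hg, c, c0, c1]

theorem apply_base_eq_or_eq (hg : ∀ i j, codeAdj (g i) (g j) = codeAdj i j) (h0 : g 0 = 0)
    (h1 : g 1 = 1) : g 98 = 98 ∨ g 98 = 85 := by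
  have a0 := hg 0 98
  have a1 := hg 1 98
  have c := commonCount_apply hg 0 1 98
  rw [h0] at a0
  rw [h1] at a1
  rw [h0, h1] at c
  exact eq_or_eq_of_cell_invariants _ a0 a1 c
    (neighborCount_apply hg (sparseCell_apply hg h0 h1) 98)

/-- An automorphism fixing `0` and `1` maps the clique to itself or to its conjugate. -/
theorem image_code_eq_or_eq (hg : ∀ i j, codeAdj (g i) (g j) = codeAdj i j) (h0 : g 0 = 0)
    (h1 : g 1 = 1) :
    g '' {0, 1, 3, 4, 98, 28, 101} = {0, 1, 3, 4, 98, 28, 101} ∨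
      g '' {0, 1, 3, 4, 98, 28, 101} = {0, 1, 3, 4, 85, 145, 88} := by
  have key := baseInvariant_apply hg h0 h1 98
  rcases apply_base_eq_or_eq hg h0 h1 with hb | hb <;> rw [hb] at key
  · left
    simp only [Set.image_insert_eq, Set.image_singleton, h0, h1, hb,
      (eq_of_baseInvariant _).1 (key 3), (eq_of_baseInvariant _).2.1 (key 4),
      (eq_of_baseInvariant _).2.2.1 (key 28), (eq_of_baseInvariant _).2.2.2 (key 101)]
  · right
    simp only [Set.image_insert_eq, Set.image_singleton, h0, h1, hb,
      (eq_of_conj_baseInvariant _).1 (key 3), (eq_of_conj_baseInvariant _).2.1 (key 4),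
      (eq_of_conj_baseInvariant _).2.2.1 (key 28), (eq_of_conj_baseInvariant _).2.2.2 (key 101)]

end Automorphism

section Field

variable {F : Type*} [Field F]

/-- The field element with code `i`. -/
def decode (α : F) (i : Fin 169) : F :=
  ((i.val % 13 : ℕ) : F) + ((i.val / 13 : ℕ) : F) * α

variable {α : F}

/-- The clique, as the set of elements with given codes. -/
theorem clique_eq_image_decode (h13 : (13 : F) = 0) :
    ({0, 1, 3, 4, 7 * (α + 1), 2 * (α + 1), 7 * (α + 7)} : Set F) =
      decode α '' {0, 1, 3, 4, 98, 28, 101} := by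
  have e : 7 * (α + 7) = 10 + 7 * α := by linear_combination 3 * h13
  simp only [Set.image_insert_eq, Set.image_singleton, e]
  simp [decode, mul_add, add_comm]

theorem conj_clique_eq_image_decode (h13 : (13 : F) = 0) :
    decode α '' {0, 1, 3, 4, 85, 145, 88} = (fun x : F => -x + 4) ''
      ({0, 1, 3, 4, 7 * (α + 1), 2 * (α + 1), 7 * (α + 7)} : Set F) := by
  have e1 : -(1 : F) + 4 = 3 := by ring
  have e2 : -(3 : F) + 4 = 1 := by ring
  have e3 : -(7 * (α + 1)) + 4 = 10 + 6 * α := by linear_combination (-1 - α) * h13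
  have e4 : -(2 * (α + 1)) + 4 = 2 + 11 * α := by linear_combination (-α) * h13
  have e5 : -(7 * (α + 7)) + 4 = 7 + 6 * α := by linear_combination (-4 - α) * h13
  simp only [Set.image_insert_eq, Set.image_singleton, e1, e2, e3, e4, e5]
  ext x
  simp [decode]
  tauto

theorem decode_sub_decode (h13 : (13 : F) = 0) (i j : Fin 169) :
    decode α i - decode α j = ((i.val % 13 + 13 - j.val % 13 : ℕ) : F) +
      ((i.val / 13 + 13 - j.val / 13 : ℕ) : F) * α := by
  rw [Nat.cast_sub (by omega), Nat.cast_sub (by omega)]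
  push_cast
  simp only [decode]
  linear_combination (-1 - α) * h13

theorem norm_decode_sub (h13 : (13 : F) = 0) (hα : α ^ 2 = 6) (i j : Fin 169) :
    (codeNorm i j : F) = (decode α i - decode α j) *
      (((i.val % 13 + 13 - j.val % 13 : ℕ) : F) -
        ((i.val / 13 + 13 - j.val / 13 : ℕ) : F) * α) := by
  rw [decode_sub_decode h13, codeNorm]
  generalize i.val % 13 + 13 - j.val % 13 = a
  generalize i.val / 13 + 13 - j.val / 13 = b
  push_cast
  linear_combination (b : F) ^ 2 * h13 + (b : F) ^ 2 * hα

theorem decode_injective [CharP F 13] (hα : α ^ 2 = 6) : Function.Injective (decode α) := by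
  have h13 : (13 : F) = 0 := by exact_mod_cast CharP.cast_eq_zero F 13
  intro i j hij
  apply eq_of_codeNorm
  apply Nat.mod_eq_zero_of_dvd
  rw [← CharP.cast_eq_zero_iff F, norm_decode_sub h13 hα, hij, sub_self, zero_mul]

theorem add_mul_pow_thirteen [CharP F 13] (hα : α ^ 2 = 6) (a b : ℕ) :
    ((a : F) + b * α) ^ 13 = a - b * α := by
  have h13 : (13 : F) = 0 := by exact_mod_cast CharP.cast_eq_zero F 13
  have : Fact (Nat.Prime 13) := ⟨by norm_num⟩
  have cast_pow (n : ℕ) : (n : F) ^ 13 = n := map_natCast (frobenius F 13) n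
  have hα13 : α ^ 13 = -α := by
    calc α ^ 13 = (α ^ 2) ^ 6 * α := by ring
      _ = -α := by rw [hα]; linear_combination 3589 * α * h13
  rw [add_pow_char, mul_pow, cast_pow, cast_pow, hα13]
  ring

section Fintype

variable [Fintype F]

theorem isSquare_iff_pow (hF : Fintype.card F = 169) (z : F) :
    (z ≠ 0 ∧ IsSquare z) ↔ z ^ 84 = 1 := by
  have h2 : ringChar F ≠ 2 := by
    rw [Ne, FiniteField.even_card_iff_char_two, hF]
    norm_num
  constructor
  · rintro ⟨hz, hs⟩
    simpa [hF] using (FiniteField.isSquare_iff h2 hz).1 hs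
  · intro h
    have hz : z ≠ 0 := by
      rintro rfl
      simp at h
    exact ⟨hz, (FiniteField.isSquare_iff h2 hz).2 (by simpa [hF] using h)⟩

theorem isSquare_neg_one (hF : Fintype.card F = 169) : IsSquare (-1 : F) :=
  ((isSquare_iff_pow hF _).2 (Even.neg_one_pow (by decide))).2

theorem codeAdj_iff [CharP F 13] (hF : Fintype.card F = 169) (hα : α ^ 2 = 6) (i j : Fin 169) :
    codeAdj i j = true ↔ decode α i ≠ decode α j ∧ IsSquare (decode α i - decode α j) := by
  have h13 : (13 : F) = 0 := by exact_mod_cast CharP.cast_eq_zero F 13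
  have hnorm : (decode α i - decode α j) ^ 84 = ((codeNorm i j ^ 6 : ℕ) : F) := by
    rw [Nat.cast_pow, norm_decode_sub h13 hα, ← add_mul_pow_thirteen hα, ← decode_sub_decode h13]
    ring
  rw [← sub_ne_zero, isSquare_iff_pow hF, hnorm, ← Nat.cast_one, CharP.natCast_eq_natCast F 13]
  simp [codeAdj, Nat.ModEq]

theorem decode_bijective [CharP F 13] (hF : Fintype.card F = 169) (hα : α ^ 2 = 6) :
    Function.Bijective (decode α) :=
  (Fintype.bijective_iff_injective_and_card _).2 ⟨decode_injective hα, by simp [hF]⟩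

theorem ncard_nonzero_squares [CharP F 13] (hF : Fintype.card F = 169) (hα : α ^ 2 = 6) :
    {s : F | s ≠ 0 ∧ IsSquare s}.ncard = 84 := by
  have h : {s : F | s ≠ 0 ∧ IsSquare s} =
      decode α '' (Finset.univ.filter fun i => codeAdj i 0 = true : Finset (Fin 169)) := by
    ext s
    obtain ⟨i, rfl⟩ := (decode_bijective hF hα).2 s
    simp only [(decode_injective hα).mem_set_image, Finset.coe_filter, Finset.mem_univ, true_and,
      Set.mem_ofPred_eq, codeAdj_iff hF hα]
    simp [decode]
  rw [h, Set.ncard_image_of_injective _ (decode_injective hα), Set.ncard_coe_finset,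
    card_codeAdj_zero]

/-- An automorphism fixing `0` and `1` maps the clique to itself or to its conjugate. -/
theorem image_eq_or_eq_of_fixed [CharP F 13] (hF : Fintype.card F = 169) (hα : α ^ 2 = 6)
    {h : Equiv.Perm F} (hh : IsPaleyAut h) (h0 : h 0 = 0) (h1 : h 1 = 1) :
    h '' (decode α '' {0, 1, 3, 4, 98, 28, 101}) = decode α '' {0, 1, 3, 4, 98, 28, 101} ∨
      h '' (decode α '' {0, 1, 3, 4, 98, 28, 101}) = decode α '' {0, 1, 3, 4, 85, 145, 88} := by
  let e := Equiv.ofBijective (decode α) (decode_bijective hF hα)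
  let g : Equiv.Perm (Fin 169) := (e.trans h).trans e.symm
  have hcomm (i : Fin 169) : decode α (g i) = h (decode α i) := e.apply_symm_apply _
  have hg (i j : Fin 169) : codeAdj (g i) (g j) = codeAdj i j := by
    rw [Bool.eq_iff_iff, codeAdj_iff hF hα, codeAdj_iff hF hα, hcomm, hcomm]
    exact hh _ _
  have d0 : decode α 0 = 0 := by simp [decode]
  have d1 : decode α 1 = 1 := by simp [decode]
  have g0 : g 0 = 0 := decode_injective hα (by rw [hcomm, d0, h0])
  have g1 : g 1 = 1 := decode_injective hα (by rw [hcomm, d1, h1])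
  have himage (S : Set (Fin 169)) : h '' (decode α '' S) = decode α '' (g '' S) := by
    simp only [Set.image_image, hcomm]
  rw [himage]
  exact (image_code_eq_or_eq hg g0 g1).imp (congrArg _) (congrArg _)

end Fintype

theorem isPaleyAut_affine {s : F} (hs0 : s ≠ 0) (hs : IsSquare s) (γ : F) :
    ∃ e : Equiv.Perm F, ⇑e = (fun x => s * x + γ) ∧ IsPaleyAut e := by
  refine ⟨(Equiv.mulLeft₀ s hs0).trans (Equiv.addRight γ), rfl, fun a b => ?_⟩
  have hmul : IsSquare (s * (a - b)) ↔ IsSquare (a - b) := by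
    refine ⟨fun h => ?_, hs.mul⟩
    have := h.div hs
    rwa [mul_div_cancel_left₀ _ hs0] at this
  simp [← mul_sub, hmul, hs0]

theorem IsPaleyAut.trans {e f : Equiv.Perm F} (he : IsPaleyAut e) (hf : IsPaleyAut f) :
    IsPaleyAut (e.trans f) :=
  fun a b => (hf (e a) (e b)).trans (he a b)

/-- Every automorphism maps the clique to an affine image of it with square multiplier. -/
theorem exists_affine_image_of_isPaleyAut [Fintype F] [CharP F 13] (hF : Fintype.card F = 169)
    (hα : α ^ 2 = 6) {f : Equiv.Perm F} (hf : IsPaleyAut f) :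
    ∃ s γ : F, s ≠ 0 ∧ IsSquare s ∧
      f '' {0, 1, 3, 4, 7 * (α + 1), 2 * (α + 1), 7 * (α + 7)} = (fun x : F => s * x + γ) ''
        {0, 1, 3, 4, 7 * (α + 1), 2 * (α + 1), 7 * (α + 7)} := by
  have h13 : (13 : F) = 0 := by exact_mod_cast CharP.cast_eq_zero F 13
  obtain ⟨hne, hsq⟩ := (hf 1 0).2 ⟨one_ne_zero, by simp⟩
  set s := f 1 - f 0 with hs
  have hs0 : s ≠ 0 := sub_ne_zero.2 hne
  obtain ⟨e, he, heaut⟩ := isPaleyAut_affine (inv_ne_zero hs0) hsq.inv (-(s⁻¹ * f 0))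
  have hfe (x : F) : f x = s * (f.trans e) x + f 0 := by
    simp only [Equiv.trans_apply, he]
    field_simp
    ring
  have h0 : (f.trans e) 0 = 0 := by simp [he]
  have h1 : (f.trans e) 1 = 1 := by
    simp only [Equiv.trans_apply, he]
    rw [← sub_eq_add_neg, ← mul_sub, ← hs, inv_mul_cancel₀ hs0]
  have himage (S : Set F) : f '' S = (fun x => s * x + f 0) '' ((f.trans e) '' S) := by
    rw [Set.image_image]
    exact Set.image_congr fun x _ => hfe x
  have hfix := image_eq_or_eq_of_fixed hF hα (hf.trans heaut) h0 h1
  rw [conj_clique_eq_image_decode h13, ← clique_eq_image_decode h13] at hfix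
  rcases hfix with h | h
  · exact ⟨s, f 0, hs0, hsq, by rw [himage, h]⟩
  · refine ⟨-s, s * 4 + f 0, neg_ne_zero.2 hs0, ?_, ?_⟩
    · simpa using (isSquare_neg_one hF).mul hsq
    · rw [himage, h, Set.image_image]
      exact Set.image_congr fun x _ => by ring

/-- Distinct affine maps send the clique to distinct sets: about its mean `2 + 6 α`, the second
and third power sums of the clique are `5` and `4 α`, hence nonzero. -/
theorem affine_image_injective [CharP F 13] (hα : α ^ 2 = 6) {s t γ δ : F}
    (h : (fun x : F => s * x + γ) '' {0, 1, 3, 4, 7 * (α + 1), 2 * (α + 1), 7 * (α + 7)} =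
      (fun x : F => t * x + δ) '' {0, 1, 3, 4, 7 * (α + 1), 2 * (α + 1), 7 * (α + 7)})
    (hs : s ≠ 0) (ht : t ≠ 0) : s = t ∧ γ = δ := by
  classical
  have h13 : (13 : F) = 0 := by exact_mod_cast CharP.cast_eq_zero F 13
  have natCast_ne {n : ℕ} (hn : ¬ 13 ∣ n) : (n : F) ≠ 0 := fun h0 =>
    hn ((CharP.cast_eq_zero_iff F 13 n).1 h0)
  have h7 : (7 : F) ≠ 0 := by exact_mod_cast natCast_ne (n := 7) (by norm_num)
  have h5 : (5 : F) ≠ 0 := by exact_mod_cast natCast_ne (n := 5) (by norm_num)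
  have h4 : (4 : F) ≠ 0 := by exact_mod_cast natCast_ne (n := 4) (by norm_num)
  have h6 : (6 : F) ≠ 0 := by exact_mod_cast natCast_ne (n := 6) (by norm_num)
  have hα0 : α ≠ 0 := by
    rintro rfl
    exact h6 (by rw [← hα]; ring)
  let S : Finset (Fin 169) := {0, 1, 3, 4, 98, 28, 101}
  have hS : ({0, 1, 3, 4, 7 * (α + 1), 2 * (α + 1), 7 * (α + 7)} : Set F) =
      ↑(S.image (decode α)) := by
    rw [clique_eq_image_decode h13]
    simp [S, Set.image_insert_eq]
  have affine_injective {u v : F} (hu : u ≠ 0) : Function.Injective fun x : F => u * x + v :=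
    (add_left_injective v).comp (mul_right_injective₀ hu)
  have hfin : (S.image (decode α)).image (fun x => s * x + γ) =
      (S.image (decode α)).image fun x => t * x + δ := by
    rw [hS] at h
    exact_mod_cast h
  have hsum (G : F → F) : ∑ i ∈ S, G (s * decode α i + γ) = ∑ i ∈ S, G (t * decode α i + δ) := by
    have := congrArg (fun T => ∑ x ∈ T, G x) hfin
    simpa [Finset.sum_image, (affine_injective hs).injOn, (affine_injective ht).injOn,
      (decode_injective hα).injOn] using this
  have expand (G : F → F) : ∑ i ∈ S, G (decode α i) =
      G 0 + G 1 + G 3 + G 4 + G (7 + 7 * α) + G (2 + 2 * α) + G (10 + 7 * α) := by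
    simp [S, decode, add_assoc]
  set m : F := 2 + 6 * α with hm
  have hmean : s * m + γ = t * m + δ := by
    have := hsum id
    rw [expand fun x => id (s * x + γ), expand fun x => id (t * x + δ)] at this
    simp only [id] at this
    apply mul_left_cancel₀ h7
    linear_combination this + (t - s) * (1 - 2 * α) * h13
  have hcentred (G : F → F) :
      ∑ i ∈ S, G (s * (decode α i - m)) = ∑ i ∈ S, G (t * (decode α i - m)) := by
    convert hsum fun y => G (y - (s * m + γ)) using 3 with i _ i _
    · ring
    · rw [hmean]; ring
  have power_sum_two (u : F) : ∑ i ∈ S, (u * (decode α i - m)) ^ 2 = 5 * u ^ 2 := by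
    rw [expand fun x => (u * (x - m)) ^ 2, hm]
    linear_combination u ^ 2 * (162 * hα + (82 + 2 * α) * h13)
  have power_sum_three (u : F) : ∑ i ∈ S, (u * (decode α i - m)) ^ 3 = 4 * α * u ^ 3 := by
    rw [expand fun x => (u * (x - m)) ^ 3, hm]
    linear_combination u ^ 3 * ((39 - 926 * α) * hα + (67 - 421 * α) * h13)
  have hsq : s ^ 2 = t ^ 2 := by
    have := hcentred (· ^ 2)
    rw [power_sum_two, power_sum_two] at this
    exact mul_left_cancel₀ h5 this
  have hcube : s ^ 3 = t ^ 3 := by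
    have := hcentred (· ^ 3)
    rw [power_sum_three, power_sum_three] at this
    exact mul_left_cancel₀ (mul_ne_zero h4 hα0) this
  have hst : s = t := by
    apply mul_left_cancel₀ (pow_ne_zero 2 hs)
    linear_combination hcube - t * hsq
  exact ⟨hst, by rw [hst] at hmean; exact add_left_cancel hmean⟩

end Field

theorem orbit_C13B (F : Type*) [Field F] [Fintype F] (hF : Fintype.card F = 169)
    (α : F) (hα : α ^ 2 = 6) :
    paleyOrbit ({0, 1, 3, 4, 7 * (α + 1), 2 * (α + 1), 7 * (α + 7)} : Set F)
      = {D : Set F | ∃ s γ : F, s ≠ 0 ∧ IsSquare s ∧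
          D = (fun x : F => s * x + γ) ''
            ({0, 1, 3, 4, 7 * (α + 1), 2 * (α + 1), 7 * (α + 7)} : Set F)} ∧
    (paleyOrbit ({0, 1, 3, 4, 7 * (α + 1), 2 * (α + 1), 7 * (α + 7)} : Set F)).ncard
      = 14196 := by
  have : Fact (Nat.Prime 13) := ⟨by norm_num⟩
  have : CharP F 13 := charP_of_card_eq_prime_pow (f := 2) (by rw [hF]; norm_num)
  set C : Set F := {0, 1, 3, 4, 7 * (α + 1), 2 * (α + 1), 7 * (α + 7)} with hC
  have horbit : paleyOrbit C = {D : Set F | ∃ s γ : F, s ≠ 0 ∧ IsSquare s ∧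
      D = (fun x : F => s * x + γ) '' C} := by
    ext D
    constructor
    · rintro ⟨f, hf, rfl⟩
      exact exists_affine_image_of_isPaleyAut hF hα hf
    · rintro ⟨s, γ, hs0, hs, rfl⟩
      obtain ⟨e, he, heaut⟩ := isPaleyAut_affine hs0 hs γ
      exact ⟨e, heaut, by rw [he]⟩
  refine ⟨horbit, ?_⟩
  have himage : paleyOrbit C = (fun p : F × F => (fun x => p.1 * x + p.2) '' C) ''
      ({s : F | s ≠ 0 ∧ IsSquare s} ×ˢ Set.univ) := by
    rw [horbit]
    ext D
    simp [and_assoc, eq_comm]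
  rw [himage, Set.InjOn.ncard_image, Set.ncard_prod, ncard_nonzero_squares hF hα, Set.ncard_univ,
    Nat.card_eq_fintype_card, hF]
  rintro ⟨s, γ⟩ ⟨⟨hs, -⟩, -⟩ ⟨t, δ⟩ ⟨⟨ht, -⟩, -⟩ h
  exact Prod.ext_iff.2 (affine_image_injective hα h hs ht)
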